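/- Let K₀ = max{1, 2(9+ε)/r}. For every δ > 0 there exists N such that for all n ≥ N and every vertex v of 𝔾(n,p₂,p₃), the probability that the propagation component of v satisfies |C_v| ≥ K₀·ln n is at least n^{I_{ε,r}−δ}. -/

import Mathlib

open MeasureTheory Real Filter

/-- Bernoulli-type measure on `Bool` with success probability `p`. -/
noncomputable def bern (p : ℝ) : Measure Bool :=
  (ENNReal.ofReal p) • Measure.dirac true + (ENNReal.ofReal (1 - p)) • Measure.dirac false

instance bern_finite (p : ℝ) : IsFiniteMeasure (bern p) := by
  constructor
  simp only [bern, Measure.coe_add, Measure.coe_smul, Pi.add_apply, Pi.smul_apply,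
    smul_eq_mul]
  finiteness

/-- Index type of potential edges: subsets of size 2 or 3. -/
abbrev EdgeIdx (n : ℕ) := {e : Finset (Fin n) // e.card = 2 ∨ e.card = 3}

/-- The law of the random hypergraph `𝔾(n, p₂, p₃)` with `p₂ = (1-ε)/n` and
`p₃ = r/(n ln n)`: the product of Bernoulli measures over all 2- and 3-subsets. -/
noncomputable def hypMeasure (n : ℕ) (ε r : ℝ) : Measure (EdgeIdx n → Bool) :=
  Measure.pi fun e =>
    bern (if e.1.card = 2 then (1 - ε) / n else r / (n * Real.log n))

/-- `e` is an edge of the configuration `ω`. -/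
def IsEdge {n : ℕ} (ω : EdgeIdx n → Bool) (e : Finset (Fin n)) : Prop :=
  ∃ h : e.card = 2 ∨ e.card = 3, ω ⟨e, h⟩ = true

/-- The constant `I_{ε,r} = -(1/r)(ε - ε²/2 + (1-ε)ln(1-ε))`. -/
noncomputable def Ier (ε r : ℝ) : ℝ :=
  -(1 / r) * (ε - ε ^ 2 / 2 + (1 - ε) * Real.log (1 - ε))

/-- The constant `K₀ = max {1, 2(9+ε)/r}`. -/
noncomputable def K0 (ε r : ℝ) : ℝ := max 1 (2 * (9 + ε) / r)

/-- `f 0, …, f (k-1)` is a propagation sequence from the vertex set `S`: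
every `f l` is an edge and meets `S ∪ f 0 ∪ ⋯ ∪ f (l-1)` in all but exactly
one vertex. -/
def IsPropSeqFrom {n : ℕ} (ω : EdgeIdx n → Bool) (S : Finset (Fin n))
    (k : ℕ) (f : ℕ → Finset (Fin n)) : Prop :=
  (∀ i < k, IsEdge ω (f i)) ∧
  ∀ l < k, (f l ∩ (S ∪ (Finset.range l).biUnion f)).card = (f l).card - 1

/-- The propagation component of the vertex set `S`: the union of `S` with all
edges occurring in propagation sequences from `S`. -/
def propComponent {n : ℕ} (ω : EdgeIdx n → Bool) (S : Finset (Fin n)) : Set (Fin n) :=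
  ↑S ∪ {x | ∃ k f, IsPropSeqFrom ω S k f ∧ ∃ i < k, x ∈ f i}

theorem isProbabilityMeasure_bern {p : ℝ} (h0 : 0 ≤ p) (h1 : p ≤ 1) :
    IsProbabilityMeasure (bern p) := by
  constructor
  simp only [bern, Measure.coe_add, Measure.coe_smul, Pi.add_apply, Pi.smul_apply,
    smul_eq_mul, measure_univ, mul_one]
  rw [← ENNReal.ofReal_add h0 (by linarith)]
  simp

theorem bern_singleton_false {p : ℝ} : bern p {false} = ENNReal.ofReal (1 - p) := by
  simp [bern]

/-- Events depending on disjoint sets of coordinates are independent. -/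
theorem pi_real_inter_of_disjoint {ι : Type*} [Fintype ι] (ν : ι → Measure Bool)
    [∀ i, IsProbabilityMeasure (ν i)] {S T : Finset ι} (hST : Disjoint S T)
    {E F : Set (ι → Bool)}
    (hE : ∀ ω ω' : ι → Bool, (∀ i ∈ S, ω i = ω' i) → ω ∈ E → ω' ∈ E)
    (hF : ∀ ω ω' : ι → Bool, (∀ i ∈ T, ω i = ω' i) → ω ∈ F → ω' ∈ F) :
    (Measure.pi ν).real (E ∩ F) = (Measure.pi ν).real E * (Measure.pi ν).real F := by
  classical
  have hind : ProbabilityTheory.iIndepFun (fun (i : ι) (ω : ι → Bool) => ω i)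
      (Measure.pi ν) :=
    ProbabilityTheory.iIndepFun_pi (X := fun _ x => x) fun i => aemeasurable_id
  have h2 := hind.indepFun_finset S T hST (fun i => measurable_pi_apply i)
  have key : ∀ (U : Finset ι) (X : Set (ι → Bool)),
      (∀ ω ω' : ι → Bool, (∀ i ∈ U, ω i = ω' i) → ω ∈ X → ω' ∈ X) →
      (fun (ω : ι → Bool) (i : U) => ω i) ⁻¹' ((fun (ω : ι → Bool) (i : U) => ω i) '' X) = X := by
    intro U X hX
    ext ω'
    constructor
    · rintro ⟨ω, hω, h⟩
      exact hX ω ω' (fun i hi => congrFun h ⟨i, hi⟩) hω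
    · intro h
      exact ⟨ω', h, rfl⟩
  have h3 := h2.measure_inter_preimage_eq_mul
    ((fun (ω : ι → Bool) (i : S) => ω i) '' E) ((fun (ω : ι → Bool) (i : T) => ω i) '' F)
    (Set.toFinite _).measurableSet (Set.toFinite _).measurableSet
  rw [key S E hE, key T F hF] at h3
  simp only [measureReal_def, h3, ENNReal.toReal_mul]

/-- The probability that no coordinate in `D` is `true`. -/
theorem pi_real_forall_false {ι : Type*} [Fintype ι] (p : ι → ℝ)
    [∀ i, IsProbabilityMeasure (bern (p i))] (hp : ∀ i, p i ≤ 1) (D : Finset ι) :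
    (Measure.pi fun i => bern (p i)).real {ω | ∀ i ∈ D, ω i = false} =
      ∏ i ∈ D, (1 - p i) := by
  classical
  have h : {ω : ι → Bool | ∀ i ∈ D, ω i = false} =
      Set.pi Set.univ fun i => if i ∈ D then {false} else Set.univ := by
    ext ω
    simp only [Set.mem_ofPred_eq, Set.mem_pi, Set.mem_univ, true_implies]
    refine forall_congr' fun i => ?_
    by_cases hi : i ∈ D <;> simp [hi]
  rw [h, measureReal_def, Measure.pi_pi, ENNReal.toReal_prod, ← Finset.prod_subset
    (Finset.subset_univ D)]
  · refine Finset.prod_congr rfl fun i hi => ?_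
    simp only [if_pos hi, bern_singleton_false]
    exact ENNReal.toReal_ofReal (by linarith [hp i])
  · intro i _ hi
    simp only [if_neg hi, measure_univ, ENNReal.toReal_one]

/-- The law of the set of indices `w ∈ W` whose block `D w` contains a `true` coordinate. -/
theorem pi_real_blocks {ι κ : Type*} [Fintype ι] [DecidableEq κ] (p : ι → ℝ)
    [∀ i, IsProbabilityMeasure (bern (p i))] (hp : ∀ i, p i ≤ 1) (D : κ → Finset ι)
    (W H : Finset κ) (hD : ∀ w ∈ W, ∀ w' ∈ W, w ≠ w' → Disjoint (D w) (D w'))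
    {q : ℝ} (hq : ∀ w ∈ W, ∏ i ∈ D w, (1 - p i) = 1 - q) :
    (Measure.pi fun i => bern (p i)).real
        {ω | ∀ w ∈ W, (w ∈ H ↔ ∃ i ∈ D w, ω i = true)} =
      ∏ w ∈ W, if w ∈ H then q else 1 - q := by
  classical
  induction W using Finset.induction_on with
  | empty => simp
  | insert a W ha ih =>
    rw [Finset.prod_insert ha, ← ih
      (fun w hw w' hw' => hD w (Finset.mem_insert_of_mem hw) w' (Finset.mem_insert_of_mem hw'))
      (fun w hw => hq w (Finset.mem_insert_of_mem hw))]
    have h0 : (Measure.pi fun i => bern (p i)).real {ω | (a ∈ H ↔ ∃ i ∈ D a, ω i = true)} =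
        if a ∈ H then q else 1 - q := by
      have h1 := pi_real_forall_false p hp (D a)
      rw [hq a (Finset.mem_insert_self _ _)] at h1
      by_cases haH : a ∈ H
      · have : {ω : ι → Bool | (a ∈ H ↔ ∃ i ∈ D a, ω i = true)} =
            {ω : ι → Bool | ∀ i ∈ D a, ω i = false}ᶜ := by
          ext ω; simp [haH]
        rw [this, probReal_compl_eq_one_sub (Set.toFinite _).measurableSet, h1]
        simp [haH]
      · have : {ω : ι → Bool | (a ∈ H ↔ ∃ i ∈ D a, ω i = true)} =
            {ω : ι → Bool | ∀ i ∈ D a, ω i = false} := by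
          ext ω; simp [haH]
        rw [this, h1]
        simp [haH]
    rw [← h0, ← pi_real_inter_of_disjoint _ (S := D a) (T := W.biUnion D)]
    · congr 1
      ext ω
      simp
    · rw [Finset.disjoint_biUnion_right]
      intro w hw
      refine hD a (Finset.mem_insert_self _ _) w (Finset.mem_insert_of_mem hw) ?_
      rintro rfl
      exact ha hw
    · intro ω ω' h hω
      have : (∃ i ∈ D a, ω' i = true) ↔ ∃ i ∈ D a, ω i = true :=
        exists_congr fun i => and_congr_right fun hi => by rw [h i hi]
      simpa only [Set.mem_ofPred_eq, this] using hω
    · intro ω ω' h hω w hw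
      have : (∃ i ∈ D w, ω' i = true) ↔ ∃ i ∈ D w, ω i = true :=
        exists_congr fun i => and_congr_right fun hi => by
          rw [h i (Finset.mem_biUnion.2 ⟨w, hw, hi⟩)]
      rw [this]
      exact hω w hw

/-- `GrowsBy ω A j P G`: starting from the processed vertices `P` and the active vertices `G`,
the exploration can be continued for `j` generations of exactly `A` vertices each, where every
vertex of a new generation completes an edge that meets the current generation. -/
def GrowsBy {n : ℕ} (ω : EdgeIdx n → Bool) (A : ℕ) :
    ℕ → Finset (Fin n) → Finset (Fin n) → Prop
  | 0, _, _ => True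
  | j + 1, P, G => ∃ H : Finset (Fin n), H.card = A ∧
      (∀ w ∈ H, ∃ e, IsEdge ω e ∧ e \ (P ∪ G) = {w} ∧ (e ∩ G).Nonempty) ∧
      GrowsBy ω A j (P ∪ G) H

/-- Some propagation sequence from `S` covers `X`. -/
def IsCovered {n : ℕ} (ω : EdgeIdx n → Bool) (S X : Finset (Fin n)) : Prop :=
  ∃ k f, IsPropSeqFrom ω S k f ∧ X ⊆ S ∪ (Finset.range k).biUnion f

theorem IsCovered.subset_propComponent {n : ℕ} {ω : EdgeIdx n → Bool} {S X : Finset (Fin n)}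
    (h : IsCovered ω S X) : (X : Set (Fin n)) ⊆ propComponent ω S := by
  obtain ⟨k, f, hf, hX⟩ := h
  intro x hx
  rcases Finset.mem_union.1 (hX hx) with h | h
  · exact Or.inl h
  · simp only [Finset.mem_biUnion, Finset.mem_range] at h
    exact Or.inr ⟨k, f, hf, h⟩

theorem IsCovered.insert {n : ℕ} {ω : EdgeIdx n → Bool} {S X Y e : Finset (Fin n)} {w : Fin n}
    (h : IsCovered ω S Y) (hXY : X ⊆ Y) (he : IsEdge ω e) (hw : e \ X = {w}) :
    IsCovered ω S (insert w Y) := by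
  classical
  obtain ⟨k, f, hf, hY⟩ := h
  set Z := S ∪ (Finset.range k).biUnion f with hZ
  by_cases hwZ : w ∈ Z
  · exact ⟨k, f, hf, Finset.insert_subset hwZ hY⟩
  have hwe : w ∈ e := (Finset.mem_sdiff.1 (hw ▸ Finset.mem_singleton_self w)).1
  have heZ : e ∩ Z = e.erase w := by
    ext x
    simp only [Finset.mem_inter, Finset.mem_erase]
    constructor
    · rintro ⟨hx, hxZ⟩
      exact ⟨fun h => hwZ (h ▸ hxZ), hx⟩
    · rintro ⟨hxw, hx⟩
      refine ⟨hx, hY (hXY ?_)⟩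
      by_contra hxX
      have : x ∈ e \ X := Finset.mem_sdiff.2 ⟨hx, hxX⟩
      rw [hw] at this
      exact hxw (Finset.mem_singleton.1 this)
  have hlt : ∀ l ≤ k, (Finset.range l).biUnion (Function.update f k e) =
      (Finset.range l).biUnion f := by
    intro l hl
    refine Finset.biUnion_congr rfl fun i hi => ?_
    rw [Function.update_of_ne]
    have := Finset.mem_range.1 hi
    omega
  refine ⟨k + 1, Function.update f k e, ⟨?_, ?_⟩, ?_⟩
  · intro i hi
    rcases Nat.lt_succ_iff_lt_or_eq.1 hi with h | rfl
    · rw [Function.update_of_ne h.ne]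
      exact hf.1 i h
    · simpa using he
  · intro l hl
    rw [hlt l (by omega)]
    rcases Nat.lt_succ_iff_lt_or_eq.1 hl with h | rfl
    · rw [Function.update_of_ne h.ne]
      exact hf.2 l h
    · rw [Function.update_self, ← hZ, heZ, Finset.card_erase_of_mem hwe]
  · rw [Finset.range_add_one, Finset.biUnion_insert, hlt k le_rfl, Function.update_self]
    refine Finset.insert_subset ?_ (hY.trans ?_)
    · simp [hwe]
    · intro x hx
      simp only [hZ, Finset.mem_union] at hx ⊢
      tauto

theorem IsCovered.union {n : ℕ} {ω : EdgeIdx n → Bool} {S X : Finset (Fin n)}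
    (h : IsCovered ω S X) (H : Finset (Fin n))
    (hH : ∀ w ∈ H, ∃ e, IsEdge ω e ∧ e \ X = {w}) : IsCovered ω S (X ∪ H) := by
  classical
  induction H using Finset.induction_on with
  | empty => simpa using h
  | insert a H _ ih =>
    obtain ⟨e, he, hw⟩ := hH a (Finset.mem_insert_self _ _)
    rw [Finset.union_insert]
    exact (ih fun w hw => hH w (Finset.mem_insert_of_mem hw)).insert Finset.subset_union_left he hw

theorem disjoint_of_forall_sdiff_eq {n : ℕ} {X H : Finset (Fin n)}
    (hH : ∀ w ∈ H, ∃ e : Finset (Fin n), e \ X = {w}) : Disjoint X H := by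
  refine Finset.disjoint_right.2 fun w hw => ?_
  obtain ⟨e, he⟩ := hH w hw
  exact (Finset.mem_sdiff.1 (he ▸ Finset.mem_singleton_self w)).2

theorem GrowsBy.le_ncard_propComponent {n : ℕ} {ω : EdgeIdx n → Bool} {A : ℕ}
    {S : Finset (Fin n)} {j : ℕ} : ∀ {P G : Finset (Fin n)}, GrowsBy ω A j P G →
    IsCovered ω S (P ∪ G) → (P ∪ G).card + j * A ≤ (propComponent ω S).ncard := by
  induction j with
  | zero =>
    intro P G _ hc
    rw [zero_mul, add_zero, ← Set.ncard_coe_finset]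
    exact Set.ncard_le_ncard hc.subset_propComponent (Set.toFinite _)
  | succ j ih =>
    rintro P G ⟨H, hA, hH, hg⟩ hc
    have h := ih hg (hc.union H fun w hw => by
      obtain ⟨e, he, hw, -⟩ := hH w hw
      exact ⟨e, he, hw⟩)
    rw [Finset.card_union_of_disjoint (disjoint_of_forall_sdiff_eq fun w hw => by
      obtain ⟨e, -, hw, -⟩ := hH w hw
      exact ⟨e, hw⟩), hA] at h
    linarith [add_mul j 1 A]

theorem GrowsBy.congr {n : ℕ} {ω ω' : EdgeIdx n → Bool} {A j : ℕ} :
    ∀ {P G : Finset (Fin n)}, Disjoint P G →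
    (∀ e : EdgeIdx n, 2 ≤ (e.1 \ P).card → ω e = ω' e) → GrowsBy ω A j P G →
    GrowsBy ω' A j P G := by
  induction j with
  | zero => intros; trivial
  | succ j ih =>
    rintro P G hPG hω ⟨H, hA, hH, hg⟩
    refine ⟨H, hA, fun w hw => ?_, ih ?_ ?_ hg⟩
    · obtain ⟨e, ⟨hc, he⟩, hew, u, hu⟩ := hH w hw
      refine ⟨e, ⟨hc, ?_⟩, hew, u, hu⟩
      rw [← hω ⟨e, hc⟩, he]
      have hw' : w ∈ e \ (P ∪ G) := hew ▸ Finset.mem_singleton_self w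
      simp only [Finset.mem_sdiff, Finset.mem_union, not_or, Finset.mem_inter] at hw' hu
      refine Finset.one_lt_card.2 ⟨w, ?_, u, ?_, ?_⟩
      · simp [hw']
      · simpa [hu.1] using Finset.disjoint_right.1 hPG hu.2
      · rintro rfl
        exact hw'.2.2 hu.2
    · exact disjoint_of_forall_sdiff_eq fun w hw => by
        obtain ⟨e, -, hw, -⟩ := hH w hw
        exact ⟨e, hw⟩
    · exact fun e he => hω e (he.trans
        (Finset.card_le_card (Finset.sdiff_subset_sdiff le_rfl Finset.subset_union_left)))

/-- The potential edges that join `w` to exactly one vertex of `G` and at most one vertex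
of `M`. -/
def joiningEdges {n : ℕ} (G M : Finset (Fin n)) (w : Fin n) : Finset (EdgeIdx n) :=
  (G.image (fun u => {u, w}) ∪ (G ×ˢ M).image (fun x => {x.1, x.2, w})).subtype _

theorem joiningEdges_spec {n : ℕ} {G M X : Finset (Fin n)} {w : Fin n} (hG : G ⊆ X) (hM : M ⊆ X)
    (hw : w ∉ X) {e : EdgeIdx n} (he : e ∈ joiningEdges G M w) :
    e.1 \ X = {w} ∧ (e.1 ∩ G).Nonempty := by
  simp only [joiningEdges, Finset.mem_subtype, Finset.mem_union, Finset.mem_image,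
    Finset.mem_product, Prod.exists] at he
  rcases he with ⟨u, hu, he⟩ | ⟨u, x, ⟨hu, hx⟩, he⟩ <;> rw [← he]
  · refine ⟨?_, u, by simp [hu]⟩
    ext y
    simp only [Finset.mem_sdiff, Finset.mem_insert, Finset.mem_singleton]
    constructor
    · rintro ⟨rfl | rfl, hy⟩
      · exact absurd (hG hu) hy
      · rfl
    · rintro rfl
      exact ⟨Or.inr rfl, hw⟩
  · refine ⟨?_, u, by simp [hu]⟩
    ext y
    simp only [Finset.mem_sdiff, Finset.mem_insert, Finset.mem_singleton]
    constructor
    · rintro ⟨rfl | rfl | rfl, hy⟩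
      · exact absurd (hG hu) hy
      · exact absurd (hM hx) hy
      · rfl
    · rintro rfl
      exact ⟨Or.inr (Or.inr rfl), hw⟩

theorem prod_joiningEdges {n : ℕ} {G M : Finset (Fin n)} {w : Fin n} (hGM : Disjoint G M)
    (hwG : w ∉ G) (hwM : w ∉ M) (a b : ℝ) :
    ∏ e ∈ joiningEdges G M w, (if e.1.card = 2 then a else b) =
      a ^ G.card * b ^ (G.card * M.card) := by
  classical
  have h2 : ∀ u ∈ G, ({u, w} : Finset (Fin n)).card = 2 := fun u hu =>
    Finset.card_pair (by rintro rfl; exact hwG hu)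
  have h3 : ∀ x ∈ G ×ˢ M, ({x.1, x.2, w} : Finset (Fin n)).card = 3 := by
    intro x hx
    obtain ⟨h1, h2⟩ := Finset.mem_product.1 hx
    refine Finset.card_eq_three.2 ⟨_, _, _, ?_, ?_, ?_, rfl⟩
    · intro h
      exact Finset.disjoint_left.1 hGM h1 (h ▸ h2)
    · intro h
      exact hwG (h ▸ h1)
    · intro h
      exact hwM (h ▸ h2)
  rw [joiningEdges, Finset.prod_subtype_of_mem
    (f := fun e : Finset (Fin n) => if e.card = 2 then a else b), Finset.prod_union,
    Finset.prod_image, Finset.prod_image]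
  · congr 1
    · rw [Finset.prod_congr rfl fun u hu => if_pos (h2 u hu), Finset.prod_const]
    · rw [Finset.prod_congr rfl fun x hx => if_neg (by rw [h3 x hx]; norm_num),
        Finset.prod_const, Finset.card_product]
  · rintro ⟨u, x⟩ hx ⟨u', x'⟩ hx' h
    simp only [Finset.coe_product, Set.mem_prod, Finset.mem_coe] at hx hx' h
    have hu : u ∈ ({u', x', w} : Finset (Fin n)) := h ▸ Finset.mem_insert_self _ _
    have hy : x ∈ ({u', x', w} : Finset (Fin n)) := by rw [← h]; simp
    simp only [Finset.mem_insert, Finset.mem_singleton] at hu hy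
    have e1 : u = u' := by
      rcases hu with h | h | h
      · exact h
      · exact absurd (h ▸ hx'.2) (Finset.disjoint_left.1 hGM hx.1)
      · exact absurd (h ▸ hx.1) hwG
    have e2 : x = x' := by
      rcases hy with h | h | h
      · exact absurd hx.2 (Finset.disjoint_left.1 hGM (h ▸ hx'.1))
      · exact h
      · exact absurd (h ▸ hx.2) hwM
    rw [e1, e2]
  · intro u hu u' hu' h
    have : u ∈ ({u', w} : Finset (Fin n)) := by
      have h : ({u, w} : Finset (Fin n)) = {u', w} := h
      rw [← h]; simp
    simp only [Finset.mem_insert, Finset.mem_singleton] at this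
    rcases this with h | h
    · exact h
    · exact absurd (h ▸ hu) hwG
  · refine Finset.disjoint_left.2 fun e he he' => ?_
    obtain ⟨u, hu, rfl⟩ := Finset.mem_image.1 he
    obtain ⟨x, hx, hxe⟩ := Finset.mem_image.1 he'
    have := h3 x hx
    rw [hxe, h2 u hu] at this
    norm_num at this
  · intro e he
    rcases Finset.mem_union.1 he with h | h
    · obtain ⟨u, hu, rfl⟩ := Finset.mem_image.1 h
      exact Or.inl (h2 u hu)
    · obtain ⟨x, hx, rfl⟩ := Finset.mem_image.1 h
      exact Or.inr (h3 x hx)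

/-- One generation of the exploration: with `q` the probability that a fixed outside vertex is
reached from the active set `G` using at most one further vertex of `M ⊆ P`, the number of
reached vertices is binomial. -/
theorem growsBy_succ_prob_ge {n : ℕ} {p₂ p₃ : ℝ} (h2 : 0 ≤ p₂) (h2' : p₂ ≤ 1) (h3 : 0 ≤ p₃)
    (h3' : p₃ ≤ 1) {A j : ℕ} {P G M : Finset (Fin n)} (hPG : Disjoint P G) (hM : M ⊆ P) {c q : ℝ}
    (hq : 1 - q = (1 - p₂) ^ G.card * (1 - p₃) ^ (G.card * M.card))
    (hc : ∀ H : Finset (Fin n), H.card = A → Disjoint (P ∪ G) H →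
      c ≤ (Measure.pi fun e : EdgeIdx n => bern (if e.1.card = 2 then p₂ else p₃)).real
        {ω | GrowsBy ω A j (P ∪ G) H}) :
    ((n - (P ∪ G).card).choose A : ℝ) * (q ^ A * (1 - q) ^ (n - (P ∪ G).card - A)) * c ≤
      (Measure.pi fun e : EdgeIdx n => bern (if e.1.card = 2 then p₂ else p₃)).real
        {ω | GrowsBy ω A (j + 1) P G} := by
  classical
  set X := P ∪ G with hX
  set p : EdgeIdx n → ℝ := fun e => if e.1.card = 2 then p₂ else p₃ with hp
  have hp0 : ∀ e, 0 ≤ p e := fun e => by simp only [hp]; split_ifs <;> assumption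
  have hp1 : ∀ e, p e ≤ 1 := fun e => by simp only [hp]; split_ifs <;> assumption
  have : ∀ e, IsProbabilityMeasure (bern (p e)) := fun e =>
    isProbabilityMeasure_bern (hp0 e) (hp1 e)
  change _ ≤ (Measure.pi fun e => bern (p e)).real _
  change ∀ H, _ → _ → c ≤ (Measure.pi fun e => bern (p e)).real _ at hc
  set μ := Measure.pi fun e => bern (p e) with hμ
  have hGX : G ⊆ X := Finset.subset_union_right
  have hMX : M ⊆ X := hM.trans Finset.subset_union_left
  set D : Fin n → Finset (EdgeIdx n) := joiningEdges G M with hD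
  have hspec : ∀ w ∈ Xᶜ, ∀ e ∈ D w, e.1 \ X = {w} ∧ (e.1 ∩ G).Nonempty := fun w hw e he =>
    joiningEdges_spec hGX hMX (Finset.mem_compl.1 hw) he
  have hq0 : 0 ≤ 1 - q := by
    rw [hq]
    have := sub_nonneg.2 h2'
    have := sub_nonneg.2 h3'
    positivity
  have hq1 : 0 ≤ q := by
    have : (1 - p₂) ^ G.card * (1 - p₃) ^ (G.card * M.card) ≤ 1 :=
      mul_le_one₀ (pow_le_one₀ (by linarith) (by linarith)) (by
        have := sub_nonneg.2 h3'
        positivity) (pow_le_one₀ (by linarith) (by linarith))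
    linarith
  set E : Finset (Fin n) → Set (EdgeIdx n → Bool) := fun H =>
    {ω | ∀ w ∈ Xᶜ, (w ∈ H ↔ ∃ i ∈ D w, ω i = true)} with hE
  set F : Finset (Fin n) → Set (EdgeIdx n → Bool) := fun H =>
    {ω | GrowsBy ω A j X H} with hF
  have hcard : Xᶜ.card = n - X.card := by rw [Finset.card_compl, Fintype.card_fin]
  have hprobE : ∀ H ∈ Finset.powersetCard A Xᶜ,
      μ.real (E H) = q ^ A * (1 - q) ^ (n - X.card - A) := by
    intro H hH
    obtain ⟨hHX, hHA⟩ := Finset.mem_powersetCard.1 hH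
    rw [hE, hμ, pi_real_blocks p hp1 D Xᶜ H (q := q), Finset.prod_ite, Finset.prod_const,
      Finset.prod_const, Finset.filter_mem_eq_inter, Finset.inter_eq_right.2 hHX, hHA,
      Finset.filter_notMem_eq_sdiff, Finset.card_sdiff_of_subset hHX, hHA, hcard]
    · intro w hw w' hw' hne
      refine Finset.disjoint_left.2 fun e he he' => hne ?_
      have := (hspec w hw e he).1.symm.trans (hspec w' hw' e he').1
      exact Finset.singleton_injective this
    · intro w hw
      have hwX := Finset.mem_compl.1 hw
      rw [hq, ← prod_joiningEdges (w := w) (hPG.symm.mono_right hM) (fun h => hwX (hGX h))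
        (fun h => hwX (hMX h)) (1 - p₂) (1 - p₃)]
      refine Finset.prod_congr rfl fun e _ => ?_
      simp only [hp]
      split_ifs <;> rfl
  have hind : ∀ H ∈ Finset.powersetCard A Xᶜ, μ.real (E H ∩ F H) = μ.real (E H) * μ.real (F H) := by
    intro H hH
    have hHX : Disjoint X H :=
      Finset.disjoint_left.2 fun x hx hxH =>
        Finset.mem_compl.1 ((Finset.mem_powersetCard.1 hH).1 hxH) hx
    refine pi_real_inter_of_disjoint _ (S := Xᶜ.biUnion D)
      (T := Finset.univ.filter fun e : EdgeIdx n => 2 ≤ (e.1 \ X).card) ?_ ?_ ?_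
    · refine Finset.disjoint_left.2 fun e he he' => ?_
      obtain ⟨w, hw, hew⟩ := Finset.mem_biUnion.1 he
      have := (Finset.mem_filter.1 he').2
      rw [(hspec w hw e hew).1, Finset.card_singleton] at this
      omega
    · intro ω ω' h hω w hw
      have : (∃ i ∈ D w, ω' i = true) ↔ ∃ i ∈ D w, ω i = true :=
        exists_congr fun i => and_congr_right fun hi => by
          rw [h i (Finset.mem_biUnion.2 ⟨w, hw, hi⟩)]
      rw [this]
      exact hω w hw
    · intro ω ω' h hω
      exact GrowsBy.congr hHX (fun e he => h e (by simpa using he)) hω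
  have hsub : (⋃ H ∈ Finset.powersetCard A Xᶜ, E H ∩ F H) ⊆ {ω | GrowsBy ω A (j + 1) P G} := by
    intro ω hω
    simp only [Set.mem_iUnion, exists_prop] at hω
    obtain ⟨H, hH, hωE, hωF⟩ := hω
    obtain ⟨hHX, hHA⟩ := Finset.mem_powersetCard.1 hH
    refine ⟨H, hHA, fun w hw => ?_, hωF⟩
    obtain ⟨e, he, hωe⟩ := (hωE w (hHX hw)).1 hw
    exact ⟨e.1, ⟨e.2, hωe⟩, hspec w (hHX hw) e he⟩
  have hdisj : Set.PairwiseDisjoint (↑(Finset.powersetCard A Xᶜ))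
      (fun H => E H ∩ F H) := by
    intro H hH H' hH' hne
    refine Set.disjoint_left.2 fun ω hω hω' => hne ?_
    have hHX := (Finset.mem_powersetCard.1 (Finset.mem_coe.1 hH)).1
    have hHX' := (Finset.mem_powersetCard.1 (Finset.mem_coe.1 hH')).1
    ext w
    constructor
    · intro hw
      exact (hω'.1 w (hHX hw)).2 ((hω.1 w (hHX hw)).1 hw)
    · intro hw
      exact (hω.1 w (hHX' hw)).2 ((hω'.1 w (hHX' hw)).1 hw)
  refine le_trans ?_ (measureReal_mono hsub)
  rw [measureReal_biUnion_finset hdisj fun H _ => (Set.toFinite _).measurableSet]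
  have : ∀ H ∈ Finset.powersetCard A Xᶜ,
      q ^ A * (1 - q) ^ (n - X.card - A) * c ≤ μ.real (E H ∩ F H) := by
    intro H hH
    rw [hind H hH, hprobE H hH]
    refine mul_le_mul_of_nonneg_left (hc H (Finset.mem_powersetCard.1 hH).2 ?_) (by positivity)
    exact Finset.disjoint_left.2 fun x hx hxH =>
        Finset.mem_compl.1 ((Finset.mem_powersetCard.1 hH).1 hxH) hx
  refine le_trans (le_of_eq ?_) (Finset.sum_le_sum this)
  rw [Finset.sum_const, Finset.card_powersetCard, hcard, nsmul_eq_mul, mul_assoc]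

theorem factorial_le_pow_mul_exp (k : ℕ) :
    ((k + 1).factorial : ℝ) ≤ (k + 1 : ℝ) ^ (k + 2) * exp (-k) := by
  induction k with
  | zero => simp
  | succ k ih =>
    rw [Nat.factorial_succ]
    push_cast
    have hk : (0 : ℝ) < k + 1 := by positivity
    have hlog : exp 1 * (k + 1 : ℝ) ^ (k + 2) ≤ (k + 1 + 1 : ℝ) ^ (k + 2) := by
      have h1 : (1 : ℝ) ≤ (k + 2 : ℕ) * log ((k + 1 + 1 : ℝ) / (k + 1)) := by
        have := one_sub_inv_le_log_of_pos (x := (k + 1 + 1 : ℝ) / (k + 1)) (by positivity)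
        calc (1 : ℝ) = (k + 2 : ℕ) * (1 - ((k + 1 + 1 : ℝ) / (k + 1))⁻¹) := by
              push_cast; field_simp; ring
          _ ≤ _ := by gcongr
      have h2 := exp_le_exp.2 h1
      rw [exp_nat_mul, exp_log (by positivity), div_pow, le_div_iff₀ (by positivity)] at h2
      exact h2
    calc (k + 1 + 1 : ℝ) * (k + 1).factorial
        ≤ (k + 1 + 1) * ((k + 1 : ℝ) ^ (k + 2) * exp (-k)) := by gcongr
      _ = (k + 1 + 1) * (exp 1 * (k + 1 : ℝ) ^ (k + 2)) * exp (-(k + 1)) := by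
          rw [show -(k : ℝ) = 1 + -(k + 1) by ring, exp_add]; ring
      _ ≤ (k + 1 + 1) * (k + 1 + 1 : ℝ) ^ (k + 2) * exp (-(k + 1)) := by gcongr
      _ = _ := by ring

theorem binomial_prob_ge_half_poisson {n N A : ℕ} {x q : ℝ} (hA : 1 ≤ A) (hx0 : 0 ≤ x)
    (hxA : x ≤ A) (hn : 8 * A * (N + A) ≤ n) (hq1 : 1 - q ≤ exp (-(x / n)))
    (hq2 : 1 - x / n ≤ 1 - q) :
    x ^ A * exp (-x) / (2 * A.factorial) ≤
      ((n - N).choose A : ℝ) * (q ^ A * (1 - q) ^ (n - N - A)) := by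
  have hA' : (1 : ℝ) ≤ A := by exact_mod_cast hA
  have hnR : 8 * (A : ℝ) * (N + A) ≤ n := by exact_mod_cast hn
  have hN0 : (0 : ℝ) ≤ N := Nat.cast_nonneg _
  have hAA : 8 * ((A : ℝ) * A) ≤ n := by nlinarith
  have hn0 : (0 : ℝ) < n := by nlinarith
  set s := x / n with hs
  have hsA : s ≤ A / n := by rw [hs]; gcongr
  have hs0 : 0 ≤ s := by positivity
  have hAn : (A : ℝ) / n ≤ 1 / 8 := by
    rw [div_le_iff₀ hn0]; nlinarith
  have hAAn : (A : ℝ) * (A / n) ≤ 1 / 8 := by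
    rw [← mul_div_assoc, div_le_iff₀ hn0]; nlinarith
  have hs1 : s ≤ 1 / 8 := hsA.trans hAn
  have hqs : s * (1 - A / n) ≤ q := by
    have h1 : exp (-s) ≤ 1 / (1 + s) := by
      rw [exp_neg, ← one_div]
      exact one_div_le_one_div_of_le (by positivity) (by linarith [add_one_le_exp s])
    have h2 : 1 / (1 + s) ≤ 1 - s + s * s := by
      rw [div_le_iff₀ (by positivity)]
      nlinarith [mul_nonneg hs0 (mul_nonneg hs0 hs0)]
    nlinarith
  have hA1 : 0 ≤ 1 - (A : ℝ) / n := by linarith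
  have hq0 : 0 ≤ q := le_trans (by positivity) hqs
  have hqA : s ^ A * (7 / 8) ≤ q ^ A := by
    calc s ^ A * (7 / 8) ≤ s ^ A * (1 - A / n) ^ A := by
          gcongr
          have := one_add_mul_le_pow (a := -((A : ℝ) / n)) (by linarith) A
          rw [← sub_eq_add_neg] at this
          linarith
      _ = (s * (1 - A / n)) ^ A := by rw [mul_pow]
      _ ≤ q ^ A := by gcongr
  have hq3 : exp (-x) * (3 / 4) ≤ (1 - q) ^ (n - N - A) := by
    calc exp (-x) * (3 / 4) ≤ exp (-x) * exp (-(2 * (A * (A / n)))) := by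
          gcongr
          linarith [add_one_le_exp (-(2 * ((A : ℝ) * (A / n))))]
      _ ≤ exp (-x) * exp (-(2 * (x * s))) := by gcongr
      _ = exp (n * (-s - 2 * s ^ 2)) := by
          rw [← exp_add]
          congr 1
          have : x = n * s := by rw [hs]; field_simp
          rw [this]; ring
      _ = exp (-s - 2 * s ^ 2) ^ n := exp_nat_mul _ _
      _ ≤ (1 - s) ^ n := by
          gcongr
          rw [← le_log_iff_exp_le (by linarith)]
          refine le_trans ?_ (one_sub_inv_le_log_of_pos (by linarith))
          rw [le_sub_iff_add_le, ← le_sub_iff_add_le', inv_eq_one_div,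
            div_le_iff₀ (by linarith)]
          nlinarith [mul_nonneg (mul_nonneg hs0 hs0) (show 0 ≤ 1 - 2 * s by linarith)]
      _ ≤ (1 - q) ^ n := by
          have : 0 ≤ 1 - s := by linarith
          gcongr
      _ ≤ (1 - q) ^ (n - N - A) :=
          pow_le_pow_of_le_one (by linarith) (by linarith) (by omega)
  have hch : (n : ℝ) ^ A * (7 / 8) ≤ A.factorial * ((n - N).choose A : ℝ) := by
    have h1 : ((n - N + 1 - A : ℕ) : ℝ) ^ A ≤ A.factorial * ((n - N).choose A : ℝ) := by
      have := Nat.pow_sub_le_descFactorial (n - N) A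
      rw [Nat.descFactorial_eq_factorial_mul_choose] at this
      exact_mod_cast this
    refine le_trans ?_ h1
    have hAN : (A : ℝ) * ((N + A) / n) ≤ 1 / 8 := by
      rw [← mul_div_assoc, div_le_iff₀ hn0]; linarith
    have hNn : ((N : ℝ) + A) / n ≤ 1 / 8 := by
      rw [div_le_iff₀ hn0]; nlinarith
    have h2 : (n : ℝ) * (1 - (N + A) / n) ≤ ((n - N + 1 - A : ℕ) : ℝ) := by
      have h3 : (n : ℝ) * (1 - (N + A) / n) = n - (N + A) := by field_simp
      have h4 : n ≤ (n - N + 1 - A) + (N + A) := by omega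
      have h5 : (n : ℝ) ≤ ((n - N + 1 - A : ℕ) : ℝ) + (N + A) := by exact_mod_cast h4
      linarith
    calc (n : ℝ) ^ A * (7 / 8) ≤ n ^ A * (1 - (N + A) / n) ^ A := by
          gcongr
          have := one_add_mul_le_pow (a := -(((N : ℝ) + A) / n)) (by linarith) A
          rw [← sub_eq_add_neg] at this
          linarith
      _ = (n * (1 - (N + A) / n)) ^ A := by rw [mul_pow]
      _ ≤ _ := by
          have : 0 ≤ 1 - ((N : ℝ) + A) / n := by linarith
          gcongr
  have hf : (0 : ℝ) < A.factorial := by exact_mod_cast A.factorial_pos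
  have hsn : s ^ A * n ^ A = x ^ A := by
    rw [← mul_pow, hs]
    congr 1
    field_simp
  rw [div_le_iff₀ (by positivity)]
  have hz : 0 ≤ x ^ A * exp (-x) := by positivity
  calc x ^ A * exp (-x) ≤ 2 * (n ^ A * (7 / 8) * (s ^ A * (7 / 8) * (exp (-x) * (3 / 4)))) := by
        rw [show 2 * ((n : ℝ) ^ A * (7 / 8) * (s ^ A * (7 / 8) * (exp (-x) * (3 / 4)))) =
          147 / 128 * ((s ^ A * n ^ A) * exp (-x)) by ring, hsn]
        linarith
    _ ≤ 2 * (A.factorial * ((n - N).choose A : ℝ) * (q ^ A * (1 - q) ^ (n - N - A))) := by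
        gcongr
    _ = _ := by ring

/-- Half the probability that a Poisson variable with mean `x` equals `A`. -/
noncomputable def genProb (A : ℕ) (x : ℝ) : ℝ := x ^ A * exp (-x) / (2 * A.factorial)

theorem genProb_nonneg {A : ℕ} {x : ℝ} (hx : 0 ≤ x) : 0 ≤ genProb A x := by
  unfold genProb; positivity

theorem growsBy_succ_prob_ge_genProb {n : ℕ} {u t : ℝ} (hu : 0 ≤ u) (hun : u ≤ n) (ht : 0 ≤ t)
    (htn : t ≤ n) {A j m : ℕ} (hA : 1 ≤ A) {P G : Finset (Fin n)} (hPG : Disjoint P G)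
    (hm : m ≤ P.card) (hGA : G.card ≤ A) (hum : u + m * t ≤ 1)
    (hn : 8 * A * ((P ∪ G).card + A) ≤ n) {c : ℝ} (hc0 : 0 ≤ c)
    (hc : ∀ H : Finset (Fin n), H.card = A → Disjoint (P ∪ G) H →
      c ≤ (Measure.pi fun e : EdgeIdx n => bern (if e.1.card = 2 then u / n else t / n)).real
        {ω | GrowsBy ω A j (P ∪ G) H}) :
    genProb A (G.card * (u + m * t)) * c ≤
      (Measure.pi fun e : EdgeIdx n => bern (if e.1.card = 2 then u / n else t / n)).real
        {ω | GrowsBy ω A (j + 1) P G} := by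
  obtain ⟨M, hMP, hMm⟩ := Finset.exists_subset_card_eq hm
  have hn0 : (0 : ℝ) < n := by
    have : 0 < n := lt_of_lt_of_le (by positivity) hn
    exact_mod_cast this
  set a := G.card with ha
  have h2 : u / n ≤ 1 := by rw [div_le_one hn0]; exact hun
  have h3 : t / n ≤ 1 := by rw [div_le_one hn0]; exact htn
  have h2' : 0 ≤ u / n := by positivity
  have h3' : 0 ≤ t / n := by positivity
  have key := growsBy_succ_prob_ge (A := A) (j := j) h2' h2 h3' h3 hPG hMP (c := c)
    (q := 1 - (1 - u / n) ^ a * (1 - t / n) ^ (a * m)) (by rw [hMm]; ring) hc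
  refine le_trans (mul_le_mul_of_nonneg_right ?_ hc0) key
  have hxe : (a * (u + m * t) : ℝ) / n = a * (u / n) + (a * m : ℕ) * (t / n) := by
    push_cast; field_simp
  have haA : (a : ℝ) ≤ A := by exact_mod_cast hGA
  refine binomial_prob_ge_half_poisson hA (by positivity) ?_ hn ?_ ?_
  · calc (a : ℝ) * (u + m * t) ≤ A * 1 := by gcongr
      _ = A := mul_one _
  · rw [sub_sub_cancel, hxe, neg_add, exp_add, ← mul_neg, ← mul_neg, exp_nat_mul, exp_nat_mul]
    have : 0 ≤ 1 - u / n := by linarith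
    have : 0 ≤ 1 - t / n := by linarith
    gcongr <;> exact one_sub_le_exp_neg _
  · rw [sub_sub_cancel, hxe]
    have e1 := one_add_mul_le_pow (a := -(u / n)) (by linarith) a
    have e2 := one_add_mul_le_pow (a := -(t / n)) (by linarith) (a * m)
    rw [← sub_eq_add_neg] at e1 e2
    have e3 : (1 - u / n) ^ a ≤ 1 := pow_le_one₀ (by linarith) (by linarith)
    have e4 : (1 - t / n) ^ (a * m) ≤ 1 := pow_le_one₀ (by linarith) (by linarith)
    nlinarith

/-- The capped reproduction rate of the `i`-th generation. -/
noncomputable def genRate (A M : ℕ) (u t : ℝ) (i : ℕ) : ℝ := u + (min (A * i) M : ℕ) * t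

theorem growsBy_prob_ge_prod {n : ℕ} {u t : ℝ} (hu : 0 ≤ u) (hun : u ≤ n) (ht : 0 ≤ t)
    (htn : t ≤ n) {A M : ℕ} (hA : 1 ≤ A) (huM : u + M * t ≤ 1) (j : ℕ) :
    ∀ (i : ℕ) (P G : Finset (Fin n)), Disjoint P G → P.card = 1 + A * i → G.card = A →
      8 * A * (1 + A * (i + j + 1)) ≤ n →
      ∏ k ∈ Finset.range j, genProb A (A * genRate A M u t (i + k)) ≤
        (Measure.pi fun e : EdgeIdx n => bern (if e.1.card = 2 then u / n else t / n)).real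
          {ω | GrowsBy ω A j P G} := by
  have hr0 : ∀ i, 0 ≤ genRate A M u t i := fun i => by unfold genRate; positivity
  induction j with
  | zero =>
    intro i P G _ _ _ hn
    have hn0 : (0 : ℝ) < n := by
      have : 0 < n := lt_of_lt_of_le (by positivity) hn
      exact_mod_cast this
    have : ∀ e : EdgeIdx n, IsProbabilityMeasure (bern (if e.1.card = 2 then u / n else t / n)) := by
      intro e
      apply isProbabilityMeasure_bern <;> split_ifs
      · positivity
      · positivity
      · rw [div_le_one hn0]; exact hun
      · rw [div_le_one hn0]; exact htn
    simp [GrowsBy]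
  | succ j ih =>
    intro i P G hPG hP hG hn
    have hcard : (P ∪ G).card = 1 + A * (i + 1) := by
      rw [Finset.card_union_of_disjoint hPG, hP, hG]; ring
    rw [Finset.prod_range_succ', mul_comm]
    have := growsBy_succ_prob_ge_genProb (j := j) (m := min (A * i) M) hu hun ht htn hA hPG
      (c := ∏ k ∈ Finset.range j, genProb A (A * genRate A M u t (i + (k + 1))))
      (by rw [hP]; exact (min_le_left _ _).trans (by omega)) hG.le ?_ ?_ ?_ ?_
    · rwa [hG] at this
    · refine le_trans ?_ huM
      gcongr
      exact min_le_right _ _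
    · rw [hcard]
      refine le_trans (Nat.mul_le_mul_left _ ?_) hn
      nlinarith [Nat.zero_le (A * j)]
    · exact Finset.prod_nonneg fun k _ => genProb_nonneg (mul_nonneg (Nat.cast_nonneg _) (hr0 _))
    · intro H hH hd
      have := ih (i + 1) (P ∪ G) H hd hcard hH (by
        rwa [show i + 1 + j + 1 = i + (j + 1) + 1 by ring])
      simpa only [add_assoc, add_comm 1] using this

theorem log_le_half_sub_inv {x : ℝ} (hx : 1 ≤ x) : log x ≤ (x - x⁻¹) / 2 := by
  rw [← sinh_log (by linarith)]
  exact self_le_sinh_iff.2 (log_nonneg hx)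

/-- Concavity of `y ↦ y² / 2 - y log y` on `(0, 1]`. -/
theorem rate_mul_sub_le {a b : ℝ} (ha : 0 < a) (hab : a ≤ b) (hb : b ≤ 1) :
    (b - 1 - log b) * (b - a) ≤ (b ^ 2 / 2 - b * log b) - (a ^ 2 / 2 - a * log a) := by
  have hb0 : 0 < b := ha.trans_le hab
  have h := log_le_half_sub_inv (x := b / a) (by rwa [le_div_iff₀ ha, one_mul])
  rw [log_div hb0.ne' ha.ne', inv_div] at h
  have h1 : a * (log b - log a) ≤ (b - a) * (a + b) / (2 * b) := by
    calc a * (log b - log a) ≤ a * ((b / a - a / b) / 2) := by gcongr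
      _ = _ := by field_simp; ring
  have h2 : (b - a) * (a + b) / (2 * b) ≤ (b - a) - (b - a) ^ 2 / 2 := by
    rw [div_le_iff₀ (by positivity)]
    nlinarith [mul_nonneg (mul_nonneg (sub_nonneg.2 hab) (sub_nonneg.2 hab)) (sub_nonneg.2 hb)]
  nlinarith

theorem rate_nonneg {b : ℝ} (hb : 0 < b) : 0 ≤ b - 1 - log b := by
  linarith [log_le_sub_one_of_pos hb]

theorem exp_neg_rate_le_genProb {A : ℕ} (hA : 1 ≤ A) {y : ℝ} (hy : 0 < y) :
    exp (-(A * (y - 1 - log y)) - log (2 * exp 1 * A)) ≤ genProb A (A * y) := by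
  obtain ⟨k, rfl⟩ : ∃ k, A = k + 1 := ⟨A - 1, by omega⟩
  have hk : (0 : ℝ) < ((k + 1 : ℕ) : ℝ) := by positivity
  have hf : (0 : ℝ) < (k + 1).factorial := by exact_mod_cast (k + 1).factorial_pos
  have hfac := factorial_le_pow_mul_exp k
  rw [exp_sub, exp_log (by positivity), genProb, div_le_div_iff₀ (by positivity) (by positivity)]
  have e1 : exp (-(((k + 1 : ℕ) : ℝ) * (y - 1 - log y))) =
      y ^ (k + 1) * exp (-(((k + 1 : ℕ) : ℝ) * y)) * (exp 1 * exp k) := by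
    rw [show -(((k + 1 : ℕ) : ℝ) * (y - 1 - log y)) =
      ((k + 1 : ℕ) : ℝ) * log y + (-(((k + 1 : ℕ) : ℝ) * y) + (1 + k)) by push_cast; ring,
      exp_add, exp_nat_mul, exp_log hy, exp_add, exp_add]
    ring
  rw [e1]
  calc y ^ (k + 1) * exp (-(((k + 1 : ℕ) : ℝ) * y)) * (exp 1 * exp k) * (2 * (k + 1).factorial)
      ≤ y ^ (k + 1) * exp (-(((k + 1 : ℕ) : ℝ) * y)) * (exp 1 * exp k) *
        (2 * ((k + 1 : ℝ) ^ (k + 2) * exp (-k))) := by gcongr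
    _ = y ^ (k + 1) * exp (-(((k + 1 : ℕ) : ℝ) * y)) * exp 1 * (exp k * exp (-k)) *
        (2 * (k + 1 : ℝ) ^ (k + 2)) := by ring
    _ = _ := by
      rw [← exp_add, add_neg_cancel, exp_zero, mul_pow]
      push_cast
      ring

theorem sum_rate_le {A M : ℕ} {u t : ℝ} (hu : 0 < u) (ht : 0 < t) (huM : u + M * t ≤ 1)
    (hM : 1 - t ≤ u + M * t) (J : ℕ) :
    ∑ i ∈ Finset.range (J + 1), A * (genRate A M u t i - 1 - log (genRate A M u t i)) ≤
      A * (u - 1 - log u) + (((genRate A M u t J) ^ 2 / 2 - genRate A M u t J *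
        log (genRate A M u t J)) - (u ^ 2 / 2 - u * log u)) / t + J * (A * (t ^ 2 / u)) := by
  induction J with
  | zero => simp [genRate]
  | succ J ih =>
    rw [Finset.sum_range_succ]
    set a := genRate A M u t J with ha
    set b := genRate A M u t (J + 1) with hb
    have ha0 : 0 < a := by rw [ha, genRate]; positivity
    have hub : u ≤ b := by
      rw [hb, genRate]
      nlinarith [Nat.cast_nonneg (α := ℝ) (min (A * (J + 1)) M)]
    have hb1 : b ≤ 1 := by
      refine le_trans ?_ huM
      rw [hb, genRate]
      gcongr
      exact min_le_right _ _
    have hab : a ≤ b := by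
      rw [ha, hb, genRate, genRate]
      gcongr
      omega
    have hb0 : 0 < b := hu.trans_le hub
    have hc := rate_mul_sub_le ha0 hab hb1
    have hstep : A * (b - 1 - log b) ≤
        ((b ^ 2 / 2 - b * log b) - (a ^ 2 / 2 - a * log a)) / t + A * (t ^ 2 / u) := by
      rcases le_total (A * (J + 1)) M with h | h
      · have hba : b - a = A * t := by
          rw [ha, hb, genRate, genRate, min_eq_left h,
            min_eq_left ((Nat.mul_le_mul_left _ (Nat.le_succ J)).trans h)]
          push_cast; ring
        rw [hba] at hc
        have h1 : A * (b - 1 - log b) ≤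
            ((b ^ 2 / 2 - b * log b) - (a ^ 2 / 2 - a * log a)) / t := by
          rw [le_div_iff₀ ht]; linarith
        have h2 : 0 ≤ A * (t ^ 2 / u) := by positivity
        linarith
      · have hbt : 1 - t ≤ b := by rw [hb, genRate, min_eq_right h]; exact hM
        have h1 : b - 1 - log b ≤ t ^ 2 / u := by
          have e1 := one_sub_inv_le_log_of_pos hb0
          have e2 : b - 1 - (1 - b⁻¹) = (1 - b) ^ 2 / b := by field_simp; ring
          calc b - 1 - log b ≤ (1 - b) ^ 2 / b := by linarith
            _ ≤ t ^ 2 / u := by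
              have : 0 ≤ 1 - b := by linarith
              gcongr
              linarith
        have h2 : 0 ≤ ((b ^ 2 / 2 - b * log b) - (a ^ 2 / 2 - a * log a)) / t := by
          refine div_nonneg (le_trans ?_ hc) ht.le
          exact mul_nonneg (rate_nonneg hb0) (by linarith)
        have h3 : A * (b - 1 - log b) ≤ A * (t ^ 2 / u) := by gcongr
        linarith
    push_cast
    simp only [sub_div] at hstep ih ⊢
    linarith

theorem exp_le_prod_genProb {A M : ℕ} {u t : ℝ} (hA : 1 ≤ A) (hu : 0 < u) (ht : 0 < t)
    (huM : u + M * t ≤ 1) (hM : 1 - t ≤ u + M * t) (J : ℕ) :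
    exp (-(A * (u - 1 - log u) + (1 / 2 - u ^ 2 / 2 + u * log u) / t + J * (A * (t ^ 2 / u)) +
        J * log (2 * exp 1 * A))) ≤
      ∏ i ∈ Finset.range J, genProb A (A * genRate A M u t i) := by
  have hr0 : ∀ i, 0 < genRate A M u t i := fun i => by unfold genRate; positivity
  have hr1 : ∀ i, genRate A M u t i ≤ 1 := fun i => by
    refine le_trans ?_ huM
    rw [genRate]
    gcongr
    exact min_le_right _ _
  have hmono : ∀ a : ℝ, 0 < a → a ≤ 1 → a ^ 2 / 2 - a * log a ≤ 1 / 2 := by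
    intro a ha0 ha1
    have := rate_mul_sub_le ha0 ha1 le_rfl
    norm_num at this
    linarith
  have hu1 : u ≤ 1 := by nlinarith [Nat.cast_nonneg (α := ℝ) M]
  refine le_trans ?_ (Finset.prod_le_prod (fun i _ => (exp_pos _).le)
    fun i _ => exp_neg_rate_le_genProb hA (hr0 i))
  rw [← exp_sum, exp_le_exp, Finset.sum_sub_distrib, Finset.sum_neg_distrib, Finset.sum_const,
    Finset.card_range, nsmul_eq_mul, neg_le, neg_sub, sub_neg_eq_add, add_comm]
  gcongr
  rcases J with _ | J
  · have h1 := hmono u hu hu1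
    have h2 : 0 ≤ (1 / 2 - u ^ 2 / 2 + u * log u) / t := div_nonneg (by linarith) ht.le
    have h3 : 0 ≤ A * (u - 1 - log u) := mul_nonneg (Nat.cast_nonneg _) (rate_nonneg hu)
    simp only [Finset.range_zero, Finset.sum_empty, Nat.cast_zero, zero_mul, add_zero]
    linarith
  · refine (sum_rate_le hu ht huM hM J).trans ?_
    have h1 := hmono _ (hr0 J) (hr1 J)
    have h2 : 0 ≤ (A : ℝ) * (t ^ 2 / u) := by positivity
    gcongr
    · linarith
    · simp

theorem exists_nat_mul_log_div_le (K δ : ℝ) (hδ : 0 < δ) :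
    ∃ A : ℕ, 1 ≤ A ∧ K * log (2 * exp 1 * A) / A ≤ δ := by
  have h1 : Tendsto (fun A : ℕ => log (A : ℝ) / A) atTop (nhds 0) :=
    (isLittleO_log_id_atTop.tendsto_div_nhds_zero).comp tendsto_natCast_atTop_atTop
  have h2 : Tendsto (fun A : ℕ => log (2 * exp 1) / (A : ℝ)) atTop (nhds 0) :=
    tendsto_const_div_atTop_nhds_zero_nat _
  have h3 : Tendsto (fun A : ℕ => K * (log (2 * exp 1) / (A : ℝ) + log (A : ℝ) / A)) atTop
      (nhds 0) := by simpa using (h2.add h1).const_mul K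
  obtain ⟨A, hA, hA1⟩ := ((h3.eventually (gt_mem_nhds hδ)).and (eventually_ge_atTop 1)).exists
  refine ⟨A, hA1, le_of_eq_of_le ?_ hA.le⟩
  have : (A : ℝ) ≠ 0 := by positivity
  rw [log_mul (by positivity) this]
  ring

theorem growsBy_singleton_prob_ge {n : ℕ} {u t : ℝ} (hu : 0 < u) (hun : u ≤ n) (ht : 0 < t)
    (htn : t ≤ n) (hu1 : u < 1) {A : ℕ} (hA : 1 ≤ A) (J : ℕ)
    (hn : 8 * A * (1 + A * (J + 1)) ≤ n) (v : Fin n) :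
    genProb A u * exp (-(A * (u - 1 - log u) + (1 / 2 - u ^ 2 / 2 + u * log u) / t +
        J * (A * (t ^ 2 / u)) + J * log (2 * exp 1 * A))) ≤
      (Measure.pi fun e : EdgeIdx n => bern (if e.1.card = 2 then u / n else t / n)).real
        {ω | GrowsBy ω A (J + 1) ∅ {v}} := by
  set M := ⌊(1 - u) / t⌋₊ with hM
  have huM : u + M * t ≤ 1 := by
    have := Nat.floor_le (a := (1 - u) / t) (div_nonneg (by linarith) ht.le)
    rw [le_div_iff₀ ht] at this
    linarith
  have hMt : 1 - t ≤ u + M * t := by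
    have := Nat.lt_floor_add_one ((1 - u) / t)
    rw [div_lt_iff₀ ht] at this
    linarith
  have key := growsBy_succ_prob_ge_genProb (A := A) (j := J) (m := 0) hu.le hun ht.le htn hA
    (P := ∅) (G := {v}) (Finset.disjoint_empty_left _) (Nat.zero_le _) (by simpa using hA)
    (by simpa using hu1.le) ?_ (exp_pos (-(A * (u - 1 - log u) +
        (1 / 2 - u ^ 2 / 2 + u * log u) / t + J * (A * (t ^ 2 / u)) +
        J * log (2 * exp 1 * A)))).le ?_
  · simpa using key
  · refine le_trans (Nat.mul_le_mul_left _ ?_) hn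
    simp only [Finset.empty_union, Finset.card_singleton]
    nlinarith [Nat.zero_le (A * J)]
  · intro H hH hd
    refine (exp_le_prod_genProb hA hu ht huM hMt J).trans ?_
    have := growsBy_prob_ge_prod hu.le hun ht.le htn hA huM J 0 (∅ ∪ {v}) H hd (by simp) hH
      (by simpa using hn)
    simpa only [zero_add] using this

/-- Lower bound `n^{I_{ε,r}-o(1)}` on the probability that the propagation component
of a given vertex has at least `K₀ ln n` vertices. -/
theorem prob_component_large_lower (ε r : ℝ) (hε0 : 0 < ε) (hε1 : ε < 1) (hr : 0 < r) :
    ∀ δ > (0 : ℝ), ∃ N : ℕ, ∀ n ≥ N, ∀ v : Fin n,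
      ENNReal.ofReal ((n : ℝ) ^ (Ier ε r - δ)) ≤
        hypMeasure n ε r
          {ω | K0 ε r * Real.log n ≤ ((propComponent ω {v}).ncard : ℝ)} := by
  intro δ hδ
  set K := K0 ε r with hK
  have hK1 : 1 ≤ K := le_max_left _ _
  obtain ⟨A, hA, hAδ⟩ := exists_nat_mul_log_div_le K (δ / 2) (by positivity)
  have hA' : (1 : ℝ) ≤ A := by exact_mod_cast hA
  set u := 1 - ε with hu
  have hu0 : 0 < u := by linarith
  have hu1 : u < 1 := by linarith
  have hg : 0 < genProb A u := by
    have : (0 : ℝ) < A.factorial := by exact_mod_cast A.factorial_pos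
    unfold genProb; positivity
  set C := -log (genProb A u) + A * (u - 1 - log u) + 1 + log (2 * exp 1 * A) with hC
  have hlog : Tendsto (fun n : ℕ => log (n : ℝ)) atTop atTop :=
    tendsto_log_atTop.comp tendsto_natCast_atTop_atTop
  have hsmall : ∀ᶠ n : ℕ in atTop,
      8 * (A : ℝ) * (1 + 2 * A + K * log n) ≤ n := by
    have h1 : Tendsto (fun n : ℕ => log (n : ℝ) / n) atTop (nhds 0) :=
      (isLittleO_log_id_atTop.tendsto_div_nhds_zero).comp tendsto_natCast_atTop_atTop
    have h2 : Tendsto (fun n : ℕ => 8 * (A : ℝ) * (1 + 2 * A) / (n : ℝ)) atTop (nhds 0) :=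
      tendsto_const_div_atTop_nhds_zero_nat _
    have h3 : Tendsto (fun n : ℕ => 8 * (A : ℝ) * (1 + 2 * A) / (n : ℝ) +
        8 * A * K * (log (n : ℝ) / n)) atTop (nhds 0) := by
      simpa using h2.add (h1.const_mul (8 * (A : ℝ) * K))
    filter_upwards [h3.eventually (gt_mem_nhds one_pos), eventually_gt_atTop 0] with n hn hn0
    have hn0' : (0 : ℝ) < n := by exact_mod_cast hn0
    have : 8 * (A : ℝ) * (1 + 2 * A) / (n : ℝ) + 8 * A * K * (log (n : ℝ) / n) =
        8 * (A : ℝ) * (1 + 2 * A + K * log n) / n := by field_simp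
    rw [this, div_lt_one hn0'] at hn
    exact hn.le
  obtain ⟨N, hN⟩ := eventually_atTop.1 (((hlog.eventually_ge_atTop 1).and
    ((hlog.eventually_ge_atTop ((K + A) * r ^ 2 / u)).and
    ((hlog.eventually_ge_atTop (2 * C / δ)).and (tendsto_natCast_atTop_atTop.eventually_ge_atTop
      (max 1 r))))).and hsmall)
  refine ⟨N, fun n hn v => ?_⟩
  obtain ⟨⟨hl1, hl2, hl3, hnr⟩, hns⟩ := hN n hn
  set l := log (n : ℝ) with hl
  have hl0 : 0 < l := by linarith
  have hn1 : (1 : ℝ) ≤ n := (le_max_left _ _).trans hnr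
  have hn0 : (0 : ℝ) < n := by linarith
  have ht0 : 0 < r / l := by positivity
  have htr : r / l ≤ r := div_le_self hr.le hl1
  set J := ⌈K * l / A⌉₊ with hJ
  have hJ1 : K * l / A ≤ J := Nat.le_ceil _
  have hJ2 : (J : ℝ) ≤ K * l / A + 1 := (Nat.ceil_lt_add_one (by positivity)).le
  have hJA : K * l ≤ J * A := by rwa [div_le_iff₀ (by linarith)] at hJ1
  have hJA2 : (J : ℝ) * A ≤ K * l + A := by
    calc (J : ℝ) * A ≤ (K * l / A + 1) * A := by gcongr
      _ = K * l + A := by field_simp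
  have hnn : 8 * A * (1 + A * (J + 1)) ≤ n := by
    have : 8 * (A : ℝ) * (1 + A * (J + 1)) ≤ n := by
      refine le_trans (mul_le_mul_of_nonneg_left ?_ (by positivity)) hns
      linarith
    exact_mod_cast this
  have hmain := growsBy_singleton_prob_ge hu0 (hu1.le.trans hn1) ht0
    (htr.trans ((le_max_right _ _).trans hnr)) hu1 hA J hnn v
  have hprob : ∀ e : EdgeIdx n, IsProbabilityMeasure
      (bern (if e.1.card = 2 then u / n else r / l / n)) := by
    intro e
    apply isProbabilityMeasure_bern <;> split_ifs
    · positivity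
    · positivity
    · rw [div_le_one hn0]; exact hu1.le.trans hn1
    · rw [div_le_one hn0]; exact htr.trans ((le_max_right _ _).trans hnr)
  have hμ : hypMeasure n ε r =
      Measure.pi fun e : EdgeIdx n => bern (if e.1.card = 2 then u / n else r / l / n) := by
    unfold hypMeasure
    congr! 4
    rw [div_div, mul_comm]
  rw [hμ]
  refine ENNReal.ofReal_le_of_le_toReal ?_
  change _ ≤ (Measure.pi _).real _
  refine le_trans ?_ (hmain.trans (measureReal_mono ?_))
  · rw [rpow_def_of_pos hn0, ← hl, ← exp_log hg, ← exp_add, exp_le_exp]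
    have e1 : l * Ier ε r = -((1 / 2 - u ^ 2 / 2 + u * log u) / (r / l)) := by
      rw [Ier, hu]
      field_simp
      ring
    have e2 : J * (A * ((r / l) ^ 2 / u)) ≤ 1 := by
      calc J * (A * ((r / l) ^ 2 / u)) = (J * A) * ((r / l) ^ 2 / u) := by ring
        _ ≤ ((K + A) * l) * ((r / l) ^ 2 / u) :=
            mul_le_mul_of_nonneg_right (by nlinarith) (by positivity)
        _ = (K + A) * r ^ 2 / u / l := by field_simp
        _ ≤ 1 := by rw [div_le_one hl0]; exact hl2
    have hL0 : 0 ≤ log (2 * exp 1 * A) := by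
      refine log_nonneg ?_
      nlinarith [add_one_le_exp (1 : ℝ)]
    have e3 : J * log (2 * exp 1 * A) ≤ δ / 2 * l + log (2 * exp 1 * A) := by
      calc J * log (2 * exp 1 * A) ≤ (K * l / A + 1) * log (2 * exp 1 * A) := by gcongr
        _ = K * log (2 * exp 1 * A) / A * l + log (2 * exp 1 * A) := by ring
        _ ≤ _ := by gcongr
    have e4 : C ≤ δ / 2 * l := by
      rw [div_le_iff₀ hδ] at hl3
      linarith
    rw [mul_sub, e1]
    linarith
  · intro ω hω
    have h := GrowsBy.le_ncard_propComponent (S := {v}) hω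
      ⟨0, fun _ => ∅, ⟨fun i hi => absurd hi (Nat.not_lt_zero _),
        fun i hi => absurd hi (Nat.not_lt_zero _)⟩, by simp⟩
    have h' : (J : ℝ) * A ≤ ((propComponent ω {v}).ncard : ℝ) := by
      have : J * A ≤ (propComponent ω {v}).ncard := by
        refine le_trans ?_ h
        nlinarith
      exact_mod_cast this
    exact hJA.trans h'
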